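/- Let (p_i)_{i≥0} be nonnegative reals with ∑_{i≥0} p_i = 1, p_0 ∈ (0,1), and mean ∑_{i≥0} i·p_i ≤ 1, and let f(s) = ∑_{i≥0} p_i s^i. Define the sequence (ℓ_i)_{i≥0} by ℓ_0 = p_0, ℓ_1 = 1 − f(1−p_0), and ℓ_{i+1} = f(1 − ∑_{j=0}^{i−1} ℓ_j) − f(1 − ∑_{j=0}^{i} ℓ_j) for i ≥ 1. Then ℓ_{i+1} ≤ ℓ_i for all i ≥ 0. -/

import Mathlib

theorem pow_sub_pow_le_nat_mul_sub {a b : ℝ} (hb : 0 ≤ b) (hba : b ≤ a) (ha : a ≤ 1) (n : ℕ) :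
    a ^ n - b ^ n ≤ n * (a - b) := by
  induction n with
  | zero => simp
  | succ n ih =>
    have h₁ : a * (a ^ n - b ^ n) ≤ a ^ n - b ^ n :=
      mul_le_of_le_one_left (sub_nonneg.2 (pow_le_pow_left₀ hb hba n)) ha
    have h₂ : b ^ n * (a - b) ≤ a - b :=
      mul_le_of_le_one_left (sub_nonneg.2 hba) (pow_le_one₀ hb (hba.trans ha))
    have h₃ : a ^ (n + 1) - b ^ (n + 1) = a * (a ^ n - b ^ n) + b ^ n * (a - b) := by ring
    push_cast
    linarith

theorem summable_mul_pow_of_mem_Icc {p : ℕ → ℝ} (hp : ∀ i, 0 ≤ p i) (hs : Summable p) {s : ℝ}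
    (hs01 : s ∈ Set.Icc (0 : ℝ) 1) : Summable fun i => p i * s ^ i :=
  hs.of_nonneg_of_le (fun i => mul_nonneg (hp i) (pow_nonneg hs01.1 i))
    fun i => mul_le_of_le_one_right (hp i) (pow_le_one₀ hs01.1 hs01.2)

theorem coeff_zero_le_tsum_mul_pow {p : ℕ → ℝ} (hp : ∀ i, 0 ≤ p i) (hs : Summable p) {s : ℝ}
    (hs01 : s ∈ Set.Icc (0 : ℝ) 1) : p 0 ≤ ∑' i, p i * s ^ i := by
  simpa using (summable_mul_pow_of_mem_Icc hp hs hs01).le_tsum 0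
    fun i _ => mul_nonneg (hp i) (pow_nonneg hs01.1 i)

theorem tsum_mul_pow_le_tsum_mul_pow {p : ℕ → ℝ} (hp : ∀ i, 0 ≤ p i) (hs : Summable p) {a b : ℝ}
    (hb : 0 ≤ b) (hba : b ≤ a) (ha : a ≤ 1) :
    ∑' i, p i * b ^ i ≤ ∑' i, p i * a ^ i :=
  (summable_mul_pow_of_mem_Icc hp hs ⟨hb, hba.trans ha⟩).tsum_le_tsum
    (fun i => mul_le_mul_of_nonneg_left (pow_le_pow_left₀ hb hba i) (hp i))
    (summable_mul_pow_of_mem_Icc hp hs ⟨hb.trans hba, ha⟩)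

theorem tsum_mul_pow_sub_le_mean_mul_sub {p : ℕ → ℝ} (hp : ∀ i, 0 ≤ p i) (hs : Summable p)
    (hmean : Summable fun i : ℕ => (i : ℝ) * p i) {a b : ℝ}
    (hb : 0 ≤ b) (hba : b ≤ a) (ha : a ≤ 1) :
    ∑' i, p i * a ^ i - ∑' i, p i * b ^ i ≤ (∑' i : ℕ, (i : ℝ) * p i) * (a - b) := by
  have hsa := summable_mul_pow_of_mem_Icc hp hs ⟨hb.trans hba, ha⟩
  have hsb := summable_mul_pow_of_mem_Icc hp hs ⟨hb, hba.trans ha⟩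
  rw [← hsa.tsum_sub hsb, ← tsum_mul_right]
  refine (hsa.sub hsb).tsum_le_tsum (fun i => ?_) (hmean.mul_right _)
  calc p i * a ^ i - p i * b ^ i = p i * (a ^ i - b ^ i) := by ring
    _ ≤ p i * (i * (a - b)) :=
      mul_le_mul_of_nonneg_left (pow_sub_pow_le_nat_mul_sub hb hba ha i) (hp i)
    _ = i * p i * (a - b) := by ring

/-- The leaf-height distribution `(ℓ i)` of the root of a
Bienaymé–Galton–Watson tree with offspring distribution `(p i)` (with `p 0 ∈ (0,1)`
and mean at most 1) is nonincreasing. -/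
theorem leaf_height_distribution_monotone
    (p : ℕ → ℝ) (hp : ∀ i, 0 ≤ p i) (hsum : ∑' i, p i = 1)
    (hp0 : p 0 ∈ Set.Ioo (0 : ℝ) 1)
    (hmean_summable : Summable (fun i : ℕ => (i : ℝ) * p i))
    (hmean : ∑' i : ℕ, (i : ℝ) * p i ≤ 1)
    (f : ℝ → ℝ) (hf : ∀ s ∈ Set.Icc (0 : ℝ) 1, f s = ∑' i, p i * s ^ i)
    (ℓ : ℕ → ℝ)
    (hl0 : ℓ 0 = p 0)
    (hl1 : ℓ 1 = 1 - f (1 - p 0))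
    (hlrec : ∀ i : ℕ, 1 ≤ i →
      ℓ (i + 1) = f (1 - ∑ j ∈ Finset.range i, ℓ j) -
        f (1 - ∑ j ∈ Finset.range (i + 1), ℓ j)) :
    ∀ i : ℕ, ℓ (i + 1) ≤ ℓ i := by
  have hs : Summable p := by
    by_contra h
    simp [tsum_eq_zero_of_not_summable h] at hsum
  have hf_one : f 1 = 1 := by simp [hf 1 (by simp), hsum]
  have hf_mono : ∀ {a b : ℝ}, 0 ≤ b → b ≤ a → a ≤ 1 → f b ≤ f a := fun {a b} hb hba ha => by
    rw [hf a ⟨hb.trans hba, ha⟩, hf b ⟨hb, hba.trans ha⟩]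
    exact tsum_mul_pow_le_tsum_mul_pow hp hs hb hba ha
  have hf_lip : ∀ {a b : ℝ}, 0 ≤ b → b ≤ a → a ≤ 1 → f a - f b ≤ a - b :=
    fun {a b} hb hba ha => by
      rw [hf a ⟨hb.trans hba, ha⟩, hf b ⟨hb, hba.trans ha⟩]
      exact (tsum_mul_pow_sub_le_mean_mul_sub hp hs hmean_summable hb hba ha).trans
        (mul_le_of_le_one_left (sub_nonneg.2 hba) hmean)
  have hf_ge : ∀ {a : ℝ}, 0 ≤ a → a ≤ 1 → p 0 ≤ f a := fun {a} h₀ h₁ => by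
    rw [hf a ⟨h₀, h₁⟩]
    exact coeff_zero_le_tsum_mul_pow hp hs ⟨h₀, h₁⟩
  obtain ⟨q, hq⟩ : ∃ q : ℕ → ℝ, ∀ i, q i = 1 - ∑ j ∈ Finset.range i, ℓ j := ⟨_, fun _ => rfl⟩
  have hq_zero : q 0 = 1 := by simp [hq]
  have hq_succ : ∀ i, q (i + 1) = q i - ℓ i := fun i => by
    rw [hq, hq, Finset.sum_range_succ]
    ring
  have hl : ∀ i, ℓ (i + 1) = f (q i) - f (q (i + 1)) := fun i => by
    rcases Nat.eq_zero_or_pos i with rfl | hi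
    · rw [hq_succ, hq_zero, hf_one, hl0, hl1]
    · rw [hlrec i hi, hq, hq]
  have hq_bounds : ∀ i, 0 ≤ q (i + 1) ∧ q (i + 1) ≤ q i ∧ q i ≤ 1 ∧
      q (i + 1) = f (q i) - p 0 := by
    intro i
    induction i with
    | zero =>
      rw [hq_succ, hq_zero, hl0, hf_one]
      exact ⟨by linarith [hp0.2], by linarith [hp0.1], le_rfl, rfl⟩
    | succ i ih =>
      obtain ⟨h_nonneg, h_le, h_le_one, h_eq⟩ := ih
      have h_eq' : q (i + 1 + 1) = f (q (i + 1)) - p 0 := by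
        linarith [hq_succ (i + 1), hl i]
      exact ⟨by linarith [hf_ge h_nonneg (h_le.trans h_le_one)],
        by linarith [hf_mono h_nonneg h_le h_le_one], h_le.trans h_le_one, h_eq'⟩
  intro i
  obtain ⟨h_nonneg, h_le, h_le_one, -⟩ := hq_bounds i
  linarith [hf_lip h_nonneg h_le h_le_one, hl i, hq_succ i]
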